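/- For all real numbers x and a with x > a > 0, one has Γ(x+a)/Γ(x-a) = exp( ∫₀^∞ [ 2a e^{-t} - e^{-(x-1/2)t} sinh(a t)/sinh(t/2) ] dt/t ), with the integral converging absolutely. -/

import Mathlib

open MeasureTheory Set Real

open Filter Topology

/-- Malmsten integrand for `log Γ(z)`. -/
noncomputable def malm (z t : ℝ) : ℝ :=
  ((z - 1) * Real.exp (-t) - (Real.exp (-t) - Real.exp (-z * t)) / (1 - Real.exp (-t))) / t

lemma one_sub_exp_pos' {t : ℝ} (ht : 0 < t) : 0 < 1 - Real.exp (-t) := by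
  have : Real.exp (-t) < 1 := Real.exp_lt_one_iff.2 (by linarith)
  linarith

lemma malm_measurable (z : ℝ) : Measurable (malm z) := by
  unfold malm; fun_prop

lemma malm_one (t : ℝ) : malm 1 t = 0 := by simp [malm]

lemma malm_succ (z : ℝ) {t : ℝ} (ht : 0 < t) :
    malm (z + 1) t = malm z t + t⁻¹ * (Real.exp (-(1 * t)) - Real.exp (-(z * t))) := by
  have h := (one_sub_exp_pos' ht).ne'
  have e : Real.exp (-(z + 1) * t) = Real.exp (-z * t) * Real.exp (-t) := by
    rw [← Real.exp_add]; ring_nf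
  have e2 : Real.exp (-(z * t)) = Real.exp (-z * t) := by ring_nf
  unfold malm
  rw [e, e2, one_mul]
  field_simp
  ring

lemma malm_two {t : ℝ} (ht : 0 < t) : malm 2 t = 0 := by
  have := malm_succ 1 ht
  rw [malm_one] at this
  norm_num at this
  simpa using this

lemma exp_diff_le (a b t : ℝ) :
    Real.exp (-(a * t)) - Real.exp (-(b * t)) ≤ (b - a) * t * Real.exp (-(a * t)) := by
  have e : Real.exp (-(b * t)) = Real.exp (-(a * t)) * Real.exp (-((b - a) * t)) := by
    rw [← Real.exp_add]; ring_nf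
  have h := Real.add_one_le_exp (-((b - a) * t))
  have := mul_le_mul_of_nonneg_left h (Real.exp_pos (-(a * t))).le
  rw [e]; nlinarith

lemma frull_integrable {a b : ℝ} (ha : 0 < a) (hb : 0 < b) :
    IntegrableOn (fun t : ℝ => t⁻¹ * (Real.exp (-(a * t)) - Real.exp (-(b * t)))) (Ioi 0) := by
  have hi : IntegrableOn (fun t : ℝ => |b - a| * (Real.exp (-a * t) + Real.exp (-b * t)))
      (Ioi 0) :=
    ((exp_neg_integrableOn_Ioi 0 ha).add (exp_neg_integrableOn_Ioi 0 hb)).const_mul _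
  refine Integrable.mono' hi (by fun_prop) ?_
  filter_upwards [ae_restrict_mem measurableSet_Ioi] with t ht
  have ht : 0 < t := ht
  rw [Real.norm_eq_abs, abs_mul, abs_of_pos (inv_pos.2 ht), inv_mul_le_iff₀ ht,
    neg_mul, neg_mul]
  have h1 := exp_diff_le a b t
  have h2 := exp_diff_le b a t
  have p1 := mul_nonneg ht.le (Real.exp_pos (-(a * t))).le
  have p2 := mul_nonneg ht.le (Real.exp_pos (-(b * t))).le
  have q1 := mul_le_mul_of_nonneg_right (le_abs_self (b - a)) p1
  have q2 := mul_le_mul_of_nonneg_right (neg_le_abs (b - a)) p2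
  have r1 := mul_nonneg (abs_nonneg (b - a)) p1
  have r2 := mul_nonneg (abs_nonneg (b - a)) p2
  rw [abs_le]
  constructor <;> nlinarith

lemma frull_integral {z : ℝ} (hz : 0 < z) :
    ∫ t in Ioi (0 : ℝ), t⁻¹ * (Real.exp (-(1 * t)) - Real.exp (-(z * t))) = Real.log z := by
  have h := Frullani.integral_Ioi_eq (f := fun t : ℝ => Real.exp (-t)) (a := 1) (b := z)
    (L := 1) (R := 0) ?_ one_pos hz ?_ ?_ ?_
  · simpa using h
  · exact (by fun_prop : Continuous fun t : ℝ => Real.exp (-t)).locallyIntegrable.locallyIntegrableOn _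
  · have : Continuous fun t : ℝ => Real.exp (-t) := by fun_prop
    have := this.tendsto 0
    simp only [neg_zero, Real.exp_zero] at this
    exact this.mono_left nhdsWithin_le_nhds
  · exact Real.tendsto_exp_neg_atTop_nhds_zero
  · exact frull_integrable one_pos hz

lemma malm_convex {t : ℝ} (ht : 0 < t) (x y p q : ℝ) (hp : 0 ≤ p) (hq : 0 ≤ q)
    (hpq : p + q = 1) : malm (p * x + q * y) t ≤ p * malm x t + q * malm y t := by
  have h := (one_sub_exp_pos' ht)
  have hc := convexOn_exp.2 (mem_univ (-x * t)) (mem_univ (-y * t)) hp hq hpq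
  simp only [smul_eq_mul] at hc
  have e : p * (-x * t) + q * (-y * t) = -(p * x + q * y) * t := by ring
  rw [e] at hc
  have key : p * malm x t + q * malm y t - malm (p * x + q * y) t =
      (p * Real.exp (-x * t) + q * Real.exp (-y * t) - Real.exp (-(p * x + q * y) * t)) /
        (1 - Real.exp (-t)) / t := by
    obtain rfl : q = 1 - p := by linarith
    unfold malm
    have := h.ne'
    field_simp
    ring
  have : 0 ≤ p * malm x t + q * malm y t - malm (p * x + q * y) t := by
    rw [key]
    apply div_nonneg (div_nonneg (by linarith) h.le) ht.le
  linarith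

lemma malm_nonneg {t z : ℝ} (ht : 0 < t) (hz : 2 ≤ z) : 0 ≤ malm z t := by
  have hz1 : 0 < z - 1 := by linarith
  have h := malm_convex ht 1 z ((z - 2) / (z - 1)) (1 / (z - 1))
    (div_nonneg (by linarith) hz1.le) (by positivity) (by field_simp; ring)
  have e : (z - 2) / (z - 1) * 1 + 1 / (z - 1) * z = 2 := by field_simp; ring
  rw [e, malm_two ht, malm_one, mul_zero, zero_add] at h
  exact nonneg_of_mul_nonneg_right h (by positivity)

lemma malm_integrable_succ {z : ℝ} (hz : 0 < z) :
    IntegrableOn (malm (z + 1)) (Ioi 0) ↔ IntegrableOn (malm z) (Ioi 0) := by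
  have hf := frull_integrable one_pos hz
  constructor
  · intro h
    refine (h.sub hf).congr ?_
    filter_upwards [ae_restrict_mem measurableSet_Ioi] with t ht
    simp only [Pi.sub_apply]
    rw [malm_succ z ht]; ring
  · intro h
    refine (h.add hf).congr ?_
    filter_upwards [ae_restrict_mem measurableSet_Ioi] with t ht
    simp only [Pi.add_apply]
    rw [malm_succ z ht]

lemma malm_integrable_nat (n : ℕ) : IntegrableOn (malm (n + 1 : ℝ)) (Ioi 0) := by
  induction n with
  | zero =>
    have : malm ((0 : ℕ) + 1 : ℝ) = fun _ => 0 := by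
      funext t; simpa using malm_one t
    rw [this]; exact integrableOn_zero
  | succ k ih =>
    have := (malm_integrable_succ (z := (k + 1 : ℝ)) (by positivity)).2 ih
    simpa using this

lemma malm_integrable_two_le {z : ℝ} (hz : 2 ≤ z) : IntegrableOn (malm z) (Ioi 0) := by
  obtain ⟨n, hn⟩ := exists_nat_gt z
  refine Integrable.mono' (malm_integrable_nat n) (malm_measurable z).aestronglyMeasurable ?_
  filter_upwards [ae_restrict_mem measurableSet_Ioi] with t ht
  rw [Real.norm_eq_abs, abs_of_nonneg (malm_nonneg ht hz)]
  have hd : (0 : ℝ) < n - 1 := by linarith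
  have h := malm_convex ht 2 (n + 1) ((n + 1 - z) / (n - 1)) ((z - 2) / (n - 1))
    (div_nonneg (by linarith) hd.le) (div_nonneg (by linarith) hd.le) (by field_simp; ring)
  have e : (n + 1 - z) / (n - 1) * 2 + (z - 2) / (n - 1) * (n + 1) = z := by field_simp; ring
  rw [e, malm_two ht, mul_zero, zero_add] at h
  refine h.trans (mul_le_of_le_one_left (malm_nonneg ht (by linarith)) ?_)
  rw [div_le_one hd]; linarith

lemma malm_integrable {z : ℝ} (hz : 0 < z) : IntegrableOn (malm z) (Ioi 0) := by
  rw [← malm_integrable_succ hz, ← malm_integrable_succ (by linarith)]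
  exact malm_integrable_two_le (by linarith)

lemma malm_Gamma {z : ℝ} (hz : 0 < z) :
    Real.exp (∫ t in Ioi (0 : ℝ), malm z t) = Real.Gamma z := by
  refine Real.eq_Gamma_of_log_convex
    (f := fun z => Real.exp (∫ t in Ioi (0 : ℝ), malm z t)) ?_ ?_ ?_ ?_ hz
  · refine ⟨convex_Ioi 0, ?_⟩
    intro x hx y hy p q hp hq hpq
    have hx : 0 < x := hx
    have hy : 0 < y := hy
    have hxy : 0 < p • x + q • y := (convex_Ioi (0 : ℝ)) hx hy hp hq hpq
    simp only [Function.comp_apply, Real.log_exp, smul_eq_mul] at hxy ⊢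
    rw [← integral_const_mul, ← integral_const_mul, ← integral_add
      ((malm_integrable hx).const_mul p) ((malm_integrable hy).const_mul q)]
    refine setIntegral_mono_on (malm_integrable hxy)
      (((malm_integrable hx).const_mul p).add ((malm_integrable hy).const_mul q))
      measurableSet_Ioi ?_
    intro t ht
    exact malm_convex ht x y p q hp hq hpq
  · intro y hy
    rw [setIntegral_congr_fun measurableSet_Ioi (fun t ht => malm_succ y ht),
      integral_add (malm_integrable hy) (frull_integrable one_pos hy), frull_integral hy,
      Real.exp_add, Real.exp_log hy, mul_comm]
  · intro y _; exact Real.exp_pos _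
  · simp [malm_one]

lemma integrand_eq (x a : ℝ) {t : ℝ} (ht : 0 < t) :
    malm (x + a) t - malm (x - a) t = (2 * a * Real.exp (-t) -
          Real.exp (-(x - 1 / 2) * t) * Real.sinh (a * t) / Real.sinh (t / 2)) / t := by
  have h := (one_sub_exp_pos' ht).ne'
  have hs : Real.sinh (t / 2) ≠ 0 := (Real.sinh_pos_iff.2 (by linarith)).ne'
  have key : Real.exp (-(x - 1 / 2) * t) * Real.sinh (a * t) / Real.sinh (t / 2) =
      (Real.exp (-(x - a) * t) - Real.exp (-(x + a) * t)) / (1 - Real.exp (-t)) := by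
    rw [div_eq_div_iff hs h, Real.sinh_eq, Real.sinh_eq]
    have e1 : Real.exp (-(x - a) * t) =
        Real.exp (-(x - 1 / 2) * t) * Real.exp (a * t) * Real.exp (-(t / 2)) := by
      rw [← Real.exp_add, ← Real.exp_add]; ring_nf
    have e2 : Real.exp (-(x + a) * t) =
        Real.exp (-(x - 1 / 2) * t) * Real.exp (-(a * t)) * Real.exp (-(t / 2)) := by
      rw [← Real.exp_add, ← Real.exp_add]; ring_nf
    have e3 : Real.exp (-t) = Real.exp (-(t / 2)) * Real.exp (-(t / 2)) := by
      rw [← Real.exp_add]; ring_nf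
    have e4 : Real.exp (t / 2) * Real.exp (-(t / 2)) = 1 := by
      rw [← Real.exp_add]; simp
    rw [e1, e2, e3]
    linear_combination (-(Real.exp (-(x - 1 / 2) * t) *
      (Real.exp (a * t) - Real.exp (-(a * t))) / 2)) * e4
  rw [key]
  unfold malm
  field_simp
  ring

/-- Gamma-ratio exchange factor as an exponentiated sinh-kernel integral:
for `x > a > 0`, `Γ(x+a)/Γ(x-a) = exp ∫₀^∞ (2a e^{-t} - e^{-(x-1/2)t} sinh(at)/sinh(t/2)) dt/t`,
with the integral converging absolutely. -/
theorem Gamma_ratio_sinh_integral (x a : ℝ) (ha : 0 < a) (hax : a < x) :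
    IntegrableOn
      (fun t : ℝ =>
        (2 * a * Real.exp (-t) -
          Real.exp (-(x - 1 / 2) * t) * Real.sinh (a * t) / Real.sinh (t / 2)) / t)
      (Ioi 0) ∧
      Real.Gamma (x + a) / Real.Gamma (x - a) =
        Real.exp (∫ t in Ioi (0 : ℝ),
          (2 * a * Real.exp (-t) -
            Real.exp (-(x - 1 / 2) * t) * Real.sinh (a * t) / Real.sinh (t / 2)) / t) := by
  have h1 := malm_integrable (z := x + a) (by linarith)
  have h2 := malm_integrable (z := x - a) (by linarith)
  have hc : EqOn (fun t => malm (x + a) t - malm (x - a) t) _ (Ioi 0) :=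
    fun t ht => integrand_eq x a ht
  refine ⟨(integrableOn_congr_fun hc measurableSet_Ioi).1 (h1.sub h2), ?_⟩
  rw [← setIntegral_congr_fun measurableSet_Ioi hc, integral_sub h1 h2, Real.exp_sub,
    malm_Gamma (by linarith), malm_Gamma (by linarith)]
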